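/- Assume k is algebraically closed. Suppose f = b40·Q1·Q2, where Q1 and Q2 are irreducible polynomials in k[Y,Z] of total degree 2 whose coefficient of Y² equals 1. Then at least one of the following four cases holds: (I) b22² − 4·b40·b04 = 0; (II) b22² − 4·b40·b04 = 0 and b20² − 4·b40·b00 = 0; (III) b20² − 4·b40·b00 = 0 and b02² − 4·b04·b00 = 0; (IV) (2·b40·b02 − b22·b20)² = (b22² − 4·b40·b04)·(b20² − 4·b40·b00). -/

import Mathlib

open MvPolynomial

/-- The exponent vector `Y^i Z^j`. -/
noncomputable def expo (i j : ℕ) : Fin 2 →₀ ℕ := Finsupp.single 0 i + Finsupp.single 1 j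

lemma expo_eq_iff (i j m n : ℕ) : expo i j = expo m n ↔ i = m ∧ j = n := by
  constructor
  · intro h
    have h0 := DFunLike.congr_fun h 0
    have h1 := DFunLike.congr_fun h 1
    simp [expo] at h0 h1
    exact ⟨h0, h1⟩
  · rintro ⟨rfl, rfl⟩; rfl

lemma term_eq {k : Type*} [Field k] (c : k) (i j : ℕ) :
    (C c * X 0 ^ i * X 1 ^ j : MvPolynomial (Fin 2) k) = monomial (expo i j) c := by
  rw [X_pow_eq_monomial, X_pow_eq_monomial, C_mul_monomial, monomial_mul, expo]
  simp

lemma coeff_term {k : Type*} [Field k] (c : k) (i j m n : ℕ) :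
    coeff (expo m n) (C c * X 0 ^ i * X 1 ^ j : MvPolynomial (Fin 2) k)
      = if i = m ∧ j = n then c else 0 := by
  classical
  rw [term_eq, coeff_monomial]
  simp only [expo_eq_iff]

lemma quad_form {k : Type*} [Field k] (Q : MvPolynomial (Fin 2) k) (h : Q.totalDegree = 2)
    (h1 : coeff (Finsupp.single (0 : Fin 2) 2) Q = 1) :
    ∃ a b c d e : k, Q = C 1 * X 0 ^ 2 * X 1 ^ 0 + C a * X 0 ^ 1 * X 1 ^ 1
      + C b * X 0 ^ 0 * X 1 ^ 2 + C c * X 0 ^ 1 * X 1 ^ 0 + C d * X 0 ^ 0 * X 1 ^ 1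
      + C e * X 0 ^ 0 * X 1 ^ 0 := by
  have h1' : coeff (expo 2 0) Q = 1 := by simpa [expo] using h1
  refine ⟨coeff (expo 1 1) Q, coeff (expo 0 2) Q, coeff (expo 1 0) Q, coeff (expo 0 1) Q,
    coeff (expo 0 0) Q, ?_⟩
  ext m
  obtain ⟨i, j, rfl⟩ : ∃ i j, m = expo i j := by
    refine ⟨m 0, m 1, ?_⟩
    ext t
    fin_cases t <;> simp [expo]
  simp only [coeff_add, coeff_term]
  by_cases hij : 2 < i + j
  · have hz : coeff (expo i j) Q = 0 := by
      apply coeff_eq_zero_of_totalDegree_lt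
      have : (expo i j).degree = i + j := by simp [expo]
      rw [h]
      rw [← this, Finsupp.degree_apply] at hij
      exact hij
    rw [hz]
    repeat rw [if_neg (by omega)]
    simp
  · have hi : i ≤ 2 := by omega
    have hj : j ≤ 2 := by omega
    interval_cases i <;> interval_cases j <;> first | omega | simp [h1']

/-- Lemma A.2 of the paper: if the quartic `f` (with `b40, b04, b00 ≠ 0`) factors
over the algebraically closed field `k` as `b40·Q1·Q2` with `Q1`, `Q2` irreducible
of total degree 2 whose `Y²`-coefficient is `1`, then one of four coefficient
relations holds. -/
theorem quadratic_factorization_cases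
    {k : Type*} [Field k] [IsAlgClosed k] (hchar : ringChar k ≠ 2)
    (b40 b22 b04 b20 b02 b00 : k)
    (hb40 : b40 ≠ 0) (hb04 : b04 ≠ 0) (hb00 : b00 ≠ 0)
    (Q1 Q2 : MvPolynomial (Fin 2) k)
    (hQ1irr : Irreducible Q1) (hQ2irr : Irreducible Q2)
    (hQ1deg : Q1.totalDegree = 2) (hQ2deg : Q2.totalDegree = 2)
    (hQ1mon : MvPolynomial.coeff (Finsupp.single (0 : Fin 2) 2) Q1 = 1)
    (hQ2mon : MvPolynomial.coeff (Finsupp.single (0 : Fin 2) 2) Q2 = 1)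
    (hfac : (C b40 * X 0 ^ 4 + C b22 * X 0 ^ 2 * X 1 ^ 2 + C b20 * X 0 ^ 2
        + C b04 * X 1 ^ 4 + C b02 * X 1 ^ 2 + C b00 : MvPolynomial (Fin 2) k)
        = C b40 * Q1 * Q2) :
    (b22 ^ 2 - 4 * b40 * b04 = 0)
    ∨ (b22 ^ 2 - 4 * b40 * b04 = 0 ∧ b20 ^ 2 - 4 * b40 * b00 = 0)
    ∨ (b20 ^ 2 - 4 * b40 * b00 = 0 ∧ b02 ^ 2 - 4 * b04 * b00 = 0)
    ∨ ((2 * b40 * b02 - b22 * b20) ^ 2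
        = (b22 ^ 2 - 4 * b40 * b04) * (b20 ^ 2 - 4 * b40 * b00)) := by
  obtain ⟨a, b, c, d, e, rfl⟩ := quad_form Q1 hQ1deg hQ1mon
  obtain ⟨a2, b2, c2, d2, e2, rfl⟩ := quad_form Q2 hQ2deg hQ2mon
  have key : (C (b40) * X 0 ^ 4 * X 1 ^ 0
        + C (b22) * X 0 ^ 2 * X 1 ^ 2
        + C (b20) * X 0 ^ 2 * X 1 ^ 0
        + C (b04) * X 0 ^ 0 * X 1 ^ 4
        + C (b02) * X 0 ^ 0 * X 1 ^ 2
        + C (b00) * X 0 ^ 0 * X 1 ^ 0 : MvPolynomial (Fin 2) k)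
      = C (b40) * X 0 ^ 4 * X 1 ^ 0
        + C (b40*(a+a2)) * X 0 ^ 3 * X 1 ^ 1
        + C (b40*(c+c2)) * X 0 ^ 3 * X 1 ^ 0
        + C (b40*(b+b2+a*a2)) * X 0 ^ 2 * X 1 ^ 2
        + C (b40*(d+d2+a*c2+a2*c)) * X 0 ^ 2 * X 1 ^ 1
        + C (b40*(e+e2+c*c2)) * X 0 ^ 2 * X 1 ^ 0
        + C (b40*(a*b2+a2*b)) * X 0 ^ 1 * X 1 ^ 3
        + C (b40*(a*d2+a2*d+b*c2+b2*c)) * X 0 ^ 1 * X 1 ^ 2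
        + C (b40*(a*e2+a2*e+c*d2+c2*d)) * X 0 ^ 1 * X 1 ^ 1
        + C (b40*(c*e2+c2*e)) * X 0 ^ 1 * X 1 ^ 0
        + C (b40*(b*b2)) * X 0 ^ 0 * X 1 ^ 4
        + C (b40*(b*d2+b2*d)) * X 0 ^ 0 * X 1 ^ 3
        + C (b40*(b*e2+b2*e+d*d2)) * X 0 ^ 0 * X 1 ^ 2
        + C (b40*(d*e2+d2*e)) * X 0 ^ 0 * X 1 ^ 1
        + C (b40*(e*e2)) * X 0 ^ 0 * X 1 ^ 0 := by
    refine Eq.trans ?_ (hfac.trans ?_)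
    · simp only [pow_zero, mul_one]
    · simp only [map_add, map_mul, map_one]
      ring
  clear hfac hQ1irr hQ2irr hQ1deg hQ2deg hQ1mon hQ2mon
  have hc : ∀ i j : ℕ, _ := fun i j => congrArg (coeff (expo i j)) key
  simp only [coeff_add, coeff_term] at hc
  have e31 : 0 = b40*(a+a2) := by simpa using hc 3 1
  have e30 : 0 = b40*(c+c2) := by simpa using hc 3 0
  have e22 : b22 = b40*(b+b2+a*a2) := by simpa using hc 2 2
  have e21 : 0 = b40*(d+d2+a*c2+a2*c) := by simpa using hc 2 1
  have e20 : b20 = b40*(e+e2+c*c2) := by simpa using hc 2 0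
  have e13 : 0 = b40*(a*b2+a2*b) := by simpa using hc 1 3
  have e12 : 0 = b40*(a*d2+a2*d+b*c2+b2*c) := by simpa using hc 1 2
  have e11 : 0 = b40*(a*e2+a2*e+c*d2+c2*d) := by simpa using hc 1 1
  have e10 : 0 = b40*(c*e2+c2*e) := by simpa using hc 1 0
  have e04 : b04 = b40*(b*b2) := by simpa using hc 0 4
  have e03 : 0 = b40*(b*d2+b2*d) := by simpa using hc 0 3
  have e02 : b02 = b40*(b*e2+b2*e+d*d2) := by simpa using hc 0 2
  have e01 : 0 = b40*(d*e2+d2*e) := by simpa using hc 0 1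
  have e00 : b00 = b40*(e*e2) := by simpa using hc 0 0
  clear hc key
  have h2 : (2 : k) ≠ 0 := Ring.two_ne_zero hchar
  replace e31 := (mul_eq_zero.mp e31.symm).resolve_left hb40
  replace e30 := (mul_eq_zero.mp e30.symm).resolve_left hb40
  replace e21 := (mul_eq_zero.mp e21.symm).resolve_left hb40
  replace e13 := (mul_eq_zero.mp e13.symm).resolve_left hb40
  replace e12 := (mul_eq_zero.mp e12.symm).resolve_left hb40
  replace e11 := (mul_eq_zero.mp e11.symm).resolve_left hb40
  replace e10 := (mul_eq_zero.mp e10.symm).resolve_left hb40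
  replace e03 := (mul_eq_zero.mp e03.symm).resolve_left hb40
  replace e01 := (mul_eq_zero.mp e01.symm).resolve_left hb40
  obtain rfl : a2 = -a := by linear_combination e31
  obtain rfl : c2 = -c := by linear_combination e30
  have hb : b ≠ 0 := by rintro rfl; apply hb04; rw [e04]; ring
  have split0 : ∀ x y : k, x * y = 0 → x = 0 ∨ y = 0 := fun x y h => mul_eq_zero.mp h
  by_cases ha : a = 0
  · subst ha
    by_cases hcc : c = 0
    · subst hcc
      obtain rfl : d2 = -d := by linear_combination e21
      by_cases hd : d = 0
      · subst hd
        right; right; right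
        rw [e22, e20, e02, e04, e00]
        ring
      · left
        have hbb : b2 = b := by
          apply mul_left_cancel₀ hd
          linear_combination -e03 * (-1)
        rw [e22, e04, hbb]
        ring
    · left
      have hbb : b2 = b := by
        apply mul_left_cancel₀ hcc
        linear_combination e12
      rw [e22, e04, hbb]
      ring
  · right; right; left
    obtain rfl : b2 = b := by
      apply mul_left_cancel₀ ha
      linear_combination e13
    obtain rfl : d2 = d := by
      apply mul_left_cancel₀ ha
      linear_combination e12
    obtain rfl : e2 = e := by
      apply mul_left_cancel₀ ha
      linear_combination e11
    have hd : d2 = 0 := by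
      apply mul_left_cancel₀ (mul_ne_zero h2 hb)
      linear_combination e03
    have hcc : c = 0 := by
      apply mul_left_cancel₀ (mul_ne_zero h2 ha)
      linear_combination -e21 + 2 * hd
    subst hcc
    subst hd
    rw [e20, e00, e02, e04]
    constructor <;> ring
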